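/- arXiv:2003.06275 — 5 statements merged into one kernel-verified Lean document; each statement's English description precedes it below -/
import Mathlib

section
/- Let q be an odd prime power and F = F_q. The subspace W₅ = {[[a,0,c],[0,b,c],[c,c,c]] : a,b,c ∈ F} of Sym₃(F) (a representative of the orbit Σ₅) has point-orbit distribution [2, q−1, q−1, q²−q+1]. -/
open Matrix

/-- The number of points (1-dimensional subspaces) contained in a set `S` of `3 × 3`
matrices whose (nonzero) spanning matrices satisfy the property `P`. -/
noncomputable def ptsWith (F : Type*) [Field F] (S : Set (Matrix (Fin 3) (Fin 3) F))
    (P : Matrix (Fin 3) (Fin 3) F → Prop) : ℕ :=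
  Set.ncard {p : Submodule F (Matrix (Fin 3) (Fin 3) F) |
    ↑p ⊆ S ∧ Module.finrank F ↥p = 1 ∧ ∃ M ∈ p, M ≠ 0 ∧ P M}

/-- A matrix is exterior if it is congruent to `diag(1, −1, 0)`. -/
def Exterior {F : Type*} [Field F] (M : Matrix (Fin 3) (Fin 3) F) : Prop :=
  ∃ A : Matrix (Fin 3) (Fin 3) F, IsUnit A ∧ A * M * Aᵀ = diagonal ![1, -1, 0]

/-- A matrix is interior if it is congruent to `diag(1, −ε, 0)` for some nonsquare `ε`. -/
def Interior {F : Type*} [Field F] (M : Matrix (Fin 3) (Fin 3) F) : Prop :=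
  ∃ (A : Matrix (Fin 3) (Fin 3) F) (ε : F), IsUnit A ∧ ¬ IsSquare ε ∧
    A * M * Aᵀ = diagonal ![1, -ε, 0]

/-- `S` has point-orbit distribution `[n₁, n₂, n₃, n₄]`: it contains `n₁` rank-1 points,
`n₂` exterior rank-2 points, `n₃` interior rank-2 points and `n₄` rank-3 points. -/
def HasPointOrbitDistribution (F : Type*) [Field F] (S : Set (Matrix (Fin 3) (Fin 3) F))
    (n₁ n₂ n₃ n₄ : ℕ) : Prop :=
  ptsWith F S (fun M => M.rank = 1) = n₁ ∧
  ptsWith F S Exterior = n₂ ∧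
  ptsWith F S Interior = n₃ ∧
  ptsWith F S (fun M => M.rank = 3) = n₄

section Points

variable {F : Type*} [Field F] {T : Type*} {rep : T → Matrix (Fin 3) (Fin 3) F}
  {S : Set (Matrix (Fin 3) (Fin 3) F)} {P : Matrix (Fin 3) (Fin 3) F → Prop}

/-- Points of `S` with a scaling-invariant property can be counted on a system `rep` of
representatives of the points of `S`. -/
theorem ptsWith_eq_ncard (hP : ∀ (c : F) M, c ≠ 0 → P M → P (c • M))
    (hS : ∀ x (c : F), c • rep x ∈ S)
    (hex : ∀ M ∈ S, M ≠ 0 → ∃ x, ∃ c : F, M = c • rep x)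
    (hne : ∀ x, rep x ≠ 0)
    (hinj : ∀ x y (c : F), rep x = c • rep y → x = y) :
    ptsWith F S P = {x | P (rep x)}.ncard := by
  have hi : Function.Injective fun x => Submodule.span F {rep x} := by
    intro x y h
    have h' : rep x ∈ Submodule.span F {rep y} := by
      rw [← show Submodule.span F {rep x} = Submodule.span F {rep y} from h]
      exact Submodule.mem_span_singleton_self _
    obtain ⟨c, hc⟩ := Submodule.mem_span_singleton.1 h'
    exact hinj x y c hc.symm
  rw [← Set.ncard_image_of_injective _ hi, ptsWith]
  congr 1
  ext p
  constructor
  · rintro ⟨hpS, hp, M, hM, hM0, hPM⟩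
    obtain ⟨x, c, rfl⟩ := hex M (hpS hM) hM0
    have hc : c ≠ 0 := by rintro rfl; simp at hM0
    have hx : rep x ∈ p := by simpa [smul_smul, hc] using p.smul_mem c⁻¹ hM
    refine ⟨x, by simpa [smul_smul, hc] using hP c⁻¹ _ (inv_ne_zero hc) hPM, ?_⟩
    refine le_antisymm (by simpa using hx) fun N hN => ?_
    obtain ⟨d, hd⟩ := (finrank_eq_one_iff_of_nonzero' (⟨rep x, hx⟩ : p)
      (by simpa [Subtype.ext_iff] using hne x)).1 hp ⟨N, hN⟩
    exact Submodule.mem_span_singleton.2 ⟨d, congrArg Subtype.val hd⟩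
  · rintro ⟨x, hx, rfl⟩
    refine ⟨fun N hN => ?_, finrank_span_singleton (hne x), rep x,
      Submodule.mem_span_singleton_self _, hne x, hx⟩
    obtain ⟨c, rfl⟩ := Submodule.mem_span_singleton.1 hN
    exact hS x c

end Points

section Congruence

variable {F : Type*} [Field F] {A M N : Matrix (Fin 3) (Fin 3) F}

theorem rank_eq_of_congruent (hA : IsUnit A) (h : A * M * Aᵀ = N) : M.rank = N.rank := by
  have hdet := (isUnit_iff_isUnit_det A).1 hA
  rw [← h, rank_mul_eq_left_of_isUnit_det _ _ (by rwa [det_transpose]),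
    rank_mul_eq_right_of_isUnit_det _ _ hdet]

theorem Exterior.of_congruent (hA : IsUnit A) (h : A * M * Aᵀ = N) (hN : Exterior N) :
    Exterior M := by
  obtain ⟨B, hB, hBN⟩ := hN
  exact ⟨B * A, hB.mul hA, by rw [← hBN, ← h, transpose_mul]; simp only [Matrix.mul_assoc]⟩

theorem Interior.of_congruent (hA : IsUnit A) (h : A * M * Aᵀ = N) (hN : Interior N) :
    Interior M := by
  obtain ⟨B, ε, hB, hε, hBN⟩ := hN
  exact ⟨B * A, ε, hB.mul hA, hε,
    by rw [← hBN, ← h, transpose_mul]; simp only [Matrix.mul_assoc]⟩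

theorem congruent_symm (hA : IsUnit A) (h : A * M * Aᵀ = N) :
    ∃ B : Matrix (Fin 3) (Fin 3) F, IsUnit B ∧ B * N * Bᵀ = M := by
  have hdet := (isUnit_iff_isUnit_det A).1 hA
  refine ⟨A⁻¹, (isUnit_nonsing_inv_iff).2 hA, ?_⟩
  have h1 : A⁻¹ * A = 1 := nonsing_inv_mul _ hdet
  have h2 : Aᵀ * A⁻¹ᵀ = 1 := by rw [← transpose_mul, h1, transpose_one]
  calc A⁻¹ * N * A⁻¹ᵀ = (A⁻¹ * A) * M * (Aᵀ * A⁻¹ᵀ) := by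
        rw [← h]; simp only [Matrix.mul_assoc]
    _ = M := by rw [h1, h2, Matrix.one_mul, Matrix.mul_one]

theorem exterior_iff_of_congruent (hA : IsUnit A) (h : A * M * Aᵀ = N) :
    Exterior M ↔ Exterior N := by
  obtain ⟨B, hB, hBN⟩ := congruent_symm hA h
  exact ⟨.of_congruent hB hBN, .of_congruent hA h⟩

theorem interior_iff_of_congruent (hA : IsUnit A) (h : A * M * Aᵀ = N) :
    Interior M ↔ Interior N := by
  obtain ⟨B, hB, hBN⟩ := congruent_symm hA h
  exact ⟨.of_congruent hB hBN, .of_congruent hA h⟩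

theorem rank_diagonal_eq_two {x y : F} (hx : x ≠ 0) (hy : y ≠ 0) :
    (diagonal ![x, y, 0]).rank = 2 := by
  classical
  rw [rank_diagonal, Fintype.card_subtype]
  simp [Finset.filter, Fin.univ_succ, hx, hy]

theorem rank_diagonal_fst_eq_one {x : F} (hx : x ≠ 0) :
    (diagonal ![x, 0, 0]).rank = 1 := by
  classical
  rw [rank_diagonal, Fintype.card_subtype]
  simp [Finset.filter, Fin.univ_succ, hx]

theorem rank_diagonal_snd_eq_one {x : F} (hx : x ≠ 0) :
    (diagonal ![0, x, 0]).rank = 1 := by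
  classical
  rw [rank_diagonal, Fintype.card_subtype]
  simp [Finset.filter, Fin.univ_succ, hx]

theorem Exterior.rank_eq (h : Exterior M) : M.rank = 2 := by
  obtain ⟨A, hA, h⟩ := h
  rw [rank_eq_of_congruent hA h, rank_diagonal_eq_two one_ne_zero (by simp)]

theorem Interior.rank_eq (h : Interior M) : M.rank = 2 := by
  obtain ⟨A, ε, hA, hε, h⟩ := h
  refine (rank_eq_of_congruent hA h).trans (rank_diagonal_eq_two one_ne_zero ?_)
  intro h0
  exact hε (by simp [neg_eq_zero.1 h0])

/-- The discriminant of the nondegenerate part changes by a square under congruence. -/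
theorem mul_sq_eq_of_congruent_diagonal {x y z w : F}
    (h : A * diagonal ![x, y, 0] * Aᵀ = diagonal ![z, w, 0]) :
    z * w = x * y * (A 0 0 * A 1 1 - A 0 1 * A 1 0) ^ 2 := by
  have e := fun i j => congrFun (congrFun h i) j
  have h00 := e 0 0
  have h01 := e 0 1
  have h11 := e 1 1
  simp [mul_apply, Fin.sum_univ_three, diagonal_apply] at h00 h01 h11
  rw [← h00, ← h11]
  linear_combination (A 0 0 * x * A 1 0 + A 0 1 * y * A 1 1) * h01

variable [Fintype F]

theorem exists_mul_sq_add_mul_sq_eq_one (hodd : Odd (Fintype.card F)) {x y : F}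
    (hx : x ≠ 0) (hy : y ≠ 0) : ∃ u v : F, x * u ^ 2 + y * v ^ 2 = 1 := by
  open Polynomial in
  obtain ⟨u, v, h⟩ := FiniteField.exists_root_sum_quadratic
    (f := C x * X ^ 2 + C 0 * X + C 0) (g := C y * X ^ 2 + C 0 * X + C (-1))
    (degree_quadratic hx) (degree_quadratic hy) (Nat.odd_iff.1 hodd)
  exact ⟨u, v, by simp at h; linear_combination h⟩

theorem exists_congruent_one_diagonal (hodd : Odd (Fintype.card F)) {x y d : F}
    (hx : x ≠ 0) (hy : y ≠ 0) (hd : d ≠ 0) :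
    ∃ A : Matrix (Fin 3) (Fin 3) F, IsUnit A ∧
      A * diagonal ![x, y, 0] * Aᵀ = diagonal ![1, x * y * d ^ 2, 0] := by
  obtain ⟨u, v, h⟩ := exists_mul_sq_add_mul_sq_eq_one hodd hx hy
  refine ⟨!![u, v, 0; -(y * v * d), x * u * d, 0; 0, 0, 1], ?_, ?_⟩
  · rw [isUnit_iff_isUnit_det, isUnit_iff_ne_zero, det_fin_three]
    simp
    intro h0
    exact hd (by linear_combination h0 - d * h)
  · ext i j
    fin_cases i <;> fin_cases j <;>
      simp [mul_apply, Fin.sum_univ_three, diagonal_apply, Matrix.vecMul, dotProduct]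
    · linear_combination h
    · ring
    · ring
    · linear_combination x * y * d ^ 2 * h

theorem exterior_diagonal_iff (hodd : Odd (Fintype.card F)) {x y : F} (hx : x ≠ 0)
    (hy : y ≠ 0) : Exterior (diagonal ![x, y, 0]) ↔ IsSquare (-(x * y)) := by
  constructor
  · rintro ⟨A, -, h⟩
    have := mul_sq_eq_of_congruent_diagonal h
    set d := A 0 0 * A 1 1 - A 0 1 * A 1 0
    have hd : d ≠ 0 := by intro h0; simp [h0] at this
    exact ⟨d⁻¹, by field_simp; linear_combination this⟩
  · rintro ⟨s, hs⟩
    have h0 : s ≠ 0 := by rintro rfl; simp [hx, hy] at hs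
    obtain ⟨A, hA, h⟩ := exists_congruent_one_diagonal hodd hx hy (inv_ne_zero h0)
    refine ⟨A, hA, h.trans ?_⟩
    rw [show x * y * s⁻¹ ^ 2 = -1 by field_simp; linear_combination -hs]

theorem interior_diagonal_iff (hodd : Odd (Fintype.card F)) {x y : F} (hx : x ≠ 0)
    (hy : y ≠ 0) : Interior (diagonal ![x, y, 0]) ↔ ¬ IsSquare (-(x * y)) := by
  constructor
  · rintro ⟨A, ε, -, hε, h⟩ ⟨s, hs⟩
    have := mul_sq_eq_of_congruent_diagonal h
    exact hε ⟨s * (A 0 0 * A 1 1 - A 0 1 * A 1 0),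
      by linear_combination -this + (A 0 0 * A 1 1 - A 0 1 * A 1 0) ^ 2 * hs⟩
  · intro hs
    obtain ⟨A, hA, h⟩ := exists_congruent_one_diagonal hodd hx hy one_ne_zero
    exact ⟨A, -(x * y), hA, hs, h.trans (by simp)⟩

theorem Exterior.smul (hodd : Odd (Fintype.card F)) {c : F} (hc : c ≠ 0) (h : Exterior M) :
    Exterior (c • M) := by
  obtain ⟨A, hA, h⟩ := h
  refine .of_congruent hA (N := diagonal ![c, -c, 0]) ?_
    ((exterior_diagonal_iff hodd hc (neg_ne_zero.2 hc)).2 ⟨c, by ring⟩)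
  rw [Matrix.mul_smul, Matrix.smul_mul, h, ← diagonal_smul]
  simp

theorem Interior.smul (hodd : Odd (Fintype.card F)) {c : F} (hc : c ≠ 0) (h : Interior M) :
    Interior (c • M) := by
  obtain ⟨A, ε, hA, hε, h⟩ := h
  have h0 : ε ≠ 0 := by rintro rfl; simp at hε
  refine .of_congruent hA (N := diagonal ![c, -(c * ε), 0]) ?_
    ((interior_diagonal_iff hodd hc (by simp [hc, h0])).2 ?_)
  · rw [Matrix.mul_smul, Matrix.smul_mul, h, ← diagonal_smul]
    simp
  · rintro ⟨s, hs⟩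
    exact hε ⟨s / c, by field_simp; linear_combination hs⟩

end Congruence

section Units

variable {F : Type*} [Field F] [Fintype F]

theorem isSquare_mul_iff_not_isSquare {n x : F} (hn : ¬ IsSquare n) (hx : x ≠ 0) :
    IsSquare (n * x) ↔ ¬ IsSquare x := by
  classical
  have h0 : n ≠ 0 := by rintro rfl; simp at hn
  rw [← quadraticChar_one_iff_isSquare (mul_ne_zero h0 hx),
    ← quadraticChar_neg_one_iff_not_isSquare, map_mul,
    quadraticChar_neg_one_iff_not_isSquare.2 hn]
  omega

theorem two_mul_ncard_units_isSquare_neg (hodd : Odd (Fintype.card F)) :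
    2 * {u : Fˣ | IsSquare (-u : F)}.ncard = Fintype.card F - 1 ∧
    2 * {u : Fˣ | ¬ IsSquare (-u : F)}.ncard = Fintype.card F - 1 := by
  have hchar : ringChar F ≠ 2 := fun h => by
    have := FiniteField.even_card_iff_char_two.1 h
    have := Nat.odd_iff.1 hodd
    omega
  obtain ⟨n, hn⟩ := FiniteField.exists_nonsquare hchar
  have h0 : n ≠ 0 := by rintro rfl; simp at hn
  have him : (fun u => Units.mk0 n h0 * u) '' {u : Fˣ | ¬ IsSquare (-u : F)} =
      {u : Fˣ | IsSquare (-u : F)} := by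
    ext u
    constructor
    · rintro ⟨v, hv, rfl⟩
      have := (isSquare_mul_iff_not_isSquare hn (neg_ne_zero.2 v.ne_zero)).2 hv
      simpa using this
    · intro hu
      refine ⟨(Units.mk0 n h0)⁻¹ * u, ?_, by simp⟩
      refine (isSquare_mul_iff_not_isSquare hn (neg_ne_zero.2 (Units.ne_zero _))).1 ?_
      simpa [h0] using hu
  have hcard := Set.ncard_image_of_injective {u : Fˣ | ¬ IsSquare (-u : F)}
    (mul_right_injective (Units.mk0 n h0))
  have hadd := Set.ncard_add_ncard_compl {u : Fˣ | IsSquare (-u : F)}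
  rw [Nat.card_units, Nat.card_eq_fintype_card] at hadd
  rw [show {u : Fˣ | IsSquare (-u : F)}ᶜ = {u : Fˣ | ¬ IsSquare (-u : F)} from rfl] at hadd
  have hcard' := him ▸ hcard
  omega

end Units

section SigmaFive

variable {F : Type*} [Field F]

/-- Representatives of the points of the plane: the matrices with parameters
`(1 + s, 1 + t, 1)`, `(1, t, 0)` and `(0, 1, 0)`. -/
def sigmaFiveRep : (F × F) ⊕ Option F → Matrix (Fin 3) (Fin 3) F
  | .inl (s, t) => !![1 + s, 0, 1; 0, 1 + t, 1; 1, 1, 1]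
  | .inr (some t) => diagonal ![1, t, 0]
  | .inr none => diagonal ![0, 1, 0]

theorem ptsWith_sigmaFive {P : Matrix (Fin 3) (Fin 3) F → Prop}
    (hP : ∀ (c : F) M, c ≠ 0 → P M → P (c • M)) :
    ptsWith F {M | ∃ a b c : F, M = !![a, 0, c; 0, b, c; c, c, c]} P =
      {x | P (sigmaFiveRep x)}.ncard := by
  apply ptsWith_eq_ncard hP
  · rintro (⟨s, t⟩ | _ | t) c
    · exact ⟨c * (1 + s), c * (1 + t), c, by simp [sigmaFiveRep]⟩
    · exact ⟨0, c, 0, by ext i j; fin_cases i <;> fin_cases j <;> simp [sigmaFiveRep]⟩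
    · exact ⟨c, c * t, 0, by ext i j; fin_cases i <;> fin_cases j <;> simp [sigmaFiveRep]⟩
  · rintro _ ⟨a, b, c, rfl⟩ hne
    by_cases hc : c = 0
    · subst hc
      by_cases ha : a = 0
      · subst ha
        exact ⟨.inr none, b,
          by ext i j; fin_cases i <;> fin_cases j <;> simp [sigmaFiveRep]⟩
      · refine ⟨.inr (some (b / a)), a, ?_⟩
        ext i j
        fin_cases i <;> fin_cases j <;> simp [sigmaFiveRep]
        field_simp
    · refine ⟨.inl (a / c - 1, b / c - 1), c, ?_⟩
      ext i j
      fin_cases i <;> fin_cases j <;> simp [sigmaFiveRep] <;> field_simp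
  · rintro (⟨s, t⟩ | _ | t) h
    · simpa [sigmaFiveRep] using congrFun (congrFun h 2) 2
    · simpa [sigmaFiveRep] using congrFun (congrFun h 1) 1
    · simpa [sigmaFiveRep] using congrFun (congrFun h 0) 0
  · intro x y c h
    have h00 := congrFun (congrFun h 0) 0
    have h11 := congrFun (congrFun h 1) 1
    have h22 := congrFun (congrFun h 2) 2
    rcases x with (⟨s, t⟩ | _ | t) <;> rcases y with (⟨s', t'⟩ | _ | t') <;>
      simp [sigmaFiveRep] at h00 h11 h22 ⊢ <;> grind

theorem sigmaFiveRep_congruent_of_mul_eq_one {s t : F} (h : s * t = 1) :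
    ∃ A : Matrix (Fin 3) (Fin 3) F, IsUnit A ∧
      A * sigmaFiveRep (.inl (s, t)) * Aᵀ = diagonal ![1, s, 0] := by
  refine ⟨!![0, 0, 1; 1, 0, -1; t, 1, -1 - t], ?_, ?_⟩
  · rw [isUnit_iff_isUnit_det, isUnit_iff_ne_zero, det_fin_three]
    simp
  · ext i j
    fin_cases i <;> fin_cases j <;>
      simp [sigmaFiveRep, mul_apply, Fin.sum_univ_three] <;> grind

theorem rank_sigmaFiveRep_of_mul_ne_one {s t : F} (h : s * t ≠ 1) :
    (sigmaFiveRep (.inl (s, t))).rank = 3 := by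
  rw [rank_of_det_ne_zero]
  · simp
  · intro h0
    rw [det_fin_three] at h0
    simp [sigmaFiveRep] at h0
    exact h (by linear_combination h0)

theorem rank_sigmaFiveRep_of_mul_eq_one {s t : F} (h : s * t = 1) :
    (sigmaFiveRep (.inl (s, t))).rank = 2 := by
  obtain ⟨A, hA, hAs⟩ := sigmaFiveRep_congruent_of_mul_eq_one h
  rw [rank_eq_of_congruent hA hAs,
    rank_diagonal_eq_two one_ne_zero (left_ne_zero_of_mul_eq_one h)]

theorem rank_sigmaFiveRep_none : (sigmaFiveRep (.inr none) : Matrix _ _ F).rank = 1 :=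
  rank_diagonal_snd_eq_one one_ne_zero

theorem rank_sigmaFiveRep_some_zero :
    (sigmaFiveRep (.inr (some 0)) : Matrix _ _ F).rank = 1 :=
  rank_diagonal_fst_eq_one one_ne_zero

theorem rank_sigmaFiveRep_some {t : F} (ht : t ≠ 0) :
    (sigmaFiveRep (.inr (some t))).rank = 2 :=
  rank_diagonal_eq_two one_ne_zero ht

/-- If `P` holds only in rank two, and is governed there by a condition `Q` on the
second diagonal entry, then each unit satisfying `Q` contributes two points. -/
theorem ncard_sigmaFiveRep_rank_two [Finite F] {P : Matrix (Fin 3) (Fin 3) F → Prop}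
    {Q : F → Prop} (hrank : ∀ M, P M → M.rank = 2)
    (hcongr : ∀ A M N : Matrix (Fin 3) (Fin 3) F, IsUnit A → A * M * Aᵀ = N → (P M ↔ P N))
    (hQ : ∀ s : F, s ≠ 0 → (P (diagonal ![1, s, 0]) ↔ Q s)) :
    {x | P (sigmaFiveRep x)}.ncard = 2 * {u : Fˣ | Q u}.ncard := by
  let f : Fˣ → (F × F) ⊕ Option F := fun u => .inl (u, ↑u⁻¹)
  let g : Fˣ → (F × F) ⊕ Option F := fun u => .inr (some u)
  have hf : f.Injective := fun u v h =>
    Units.ext (Prod.ext_iff.1 (Sum.inl_injective h)).1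
  have hg : g.Injective := fun u v h =>
    Units.ext (Option.some_injective _ (Sum.inr_injective h))
  have heq : {x | P (sigmaFiveRep x)} = f '' {u | Q u} ∪ g '' {u | Q u} := by
    ext x
    rcases x with (⟨s, t⟩ | _ | t)
    · by_cases h : s * t = 1
      · obtain ⟨A, hA, hAs⟩ := sigmaFiveRep_congruent_of_mul_eq_one h
        have hs := left_ne_zero_of_mul_eq_one h
        simp only [Set.mem_ofPred_eq, hcongr _ _ _ hA hAs, hQ s hs]
        constructor
        · exact fun hq => .inl ⟨Units.mk0 s hs, hq,
            by simp [f, eq_inv_of_mul_eq_one_right h]⟩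
        · rintro (⟨u, hu, hus⟩ | ⟨u, hu, hus⟩)
          · simp only [f, Sum.inl.injEq, Prod.mk.injEq] at hus
            exact hus.1 ▸ hu
          · simp [g] at hus
      · constructor
        · intro hp
          have := hrank _ hp
          rw [rank_sigmaFiveRep_of_mul_ne_one h] at this
          omega
        · rintro (⟨u, hu, hus⟩ | ⟨u, hu, hus⟩)
          · simp only [f, Sum.inl.injEq, Prod.mk.injEq] at hus
            exact (h (by simp [← hus.1, ← hus.2])).elim
          · simp [g] at hus
    · have : ¬ P (sigmaFiveRep (.inr none)) := fun hp => by
        simpa [rank_sigmaFiveRep_none] using hrank _ hp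
      simp [this, f, g]
    · by_cases h : t = 0
      · subst h
        have : ¬ P (sigmaFiveRep (.inr (some 0))) := fun hp => by
          simpa [rank_sigmaFiveRep_some_zero] using hrank _ hp
        simp [this, f, g]
      · simp only [Set.mem_ofPred_eq]
        refine (hQ t h).trans ⟨fun hq => .inr ⟨Units.mk0 t h, hq, by simp [g]⟩, ?_⟩
        rintro (⟨u, hu, hut⟩ | ⟨u, hu, hut⟩)
        · simp [f] at hut
        · simp only [g, Sum.inr.injEq, Option.some.injEq] at hut
          exact hut ▸ hu
  rw [heq, Set.ncard_union_eq, Set.ncard_image_of_injective _ hf,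
    Set.ncard_image_of_injective _ hg, two_mul]
  rw [Set.disjoint_left]
  rintro _ ⟨u, -, rfl⟩ ⟨v, -, hv⟩
  simp [f, g] at hv

theorem ncard_sigmaFiveRep_rank_one :
    {x : (F × F) ⊕ Option F | (sigmaFiveRep x).rank = 1}.ncard = 2 := by
  rw [show {x : (F × F) ⊕ Option F | (sigmaFiveRep x).rank = 1} =
    {.inr none, .inr (some 0)} from ?_, Set.ncard_pair (by simp)]
  ext x
  rcases x with (⟨s, t⟩ | _ | t)
  · by_cases h : s * t = 1
    · simp [rank_sigmaFiveRep_of_mul_eq_one h]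
    · simp [rank_sigmaFiveRep_of_mul_ne_one h]
  · simp [rank_sigmaFiveRep_none]
  · by_cases h : t = 0
    · simp [h, rank_sigmaFiveRep_some_zero]
    · simp [h, rank_sigmaFiveRep_some h]

theorem ncard_sigmaFiveRep_rank_three [Fintype F] :
    {x : (F × F) ⊕ Option F | (sigmaFiveRep x).rank = 3}.ncard =
      Fintype.card F ^ 2 - Fintype.card F + 1 := by
  let f : Fˣ → F × F := fun u => (u, ↑u⁻¹)
  have hf : f.Injective := fun u v h => Units.ext (Prod.ext_iff.1 h).1
  have heq : {x : (F × F) ⊕ Option F | (sigmaFiveRep x).rank = 3} =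
      Sum.inl '' (Set.range f)ᶜ := by
    ext x
    rcases x with (⟨s, t⟩ | _ | t)
    · by_cases h : s * t = 1
      · have : (s, t) ∈ Set.range f :=
          ⟨Units.mk0 s (left_ne_zero_of_mul_eq_one h),
            by simp [f, eq_inv_of_mul_eq_one_right h]⟩
        simp only [Set.mem_ofPred_eq, rank_sigmaFiveRep_of_mul_eq_one h,
          Sum.inl_injective.mem_set_image, Set.mem_compl_iff, this]
        simp
      · have : (s, t) ∉ Set.range f := by
          rintro ⟨u, hu⟩
          simp only [f, Prod.mk.injEq] at hu
          exact h (by simp [← hu.1, ← hu.2])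
        simp only [Set.mem_ofPred_eq, rank_sigmaFiveRep_of_mul_ne_one h,
          Sum.inl_injective.mem_set_image, Set.mem_compl_iff, this]
        simp
    · simp [rank_sigmaFiveRep_none]
    · by_cases h : t = 0
      · simp [h, rank_sigmaFiveRep_some_zero]
      · simp [rank_sigmaFiveRep_some h]
  rw [heq, Set.ncard_image_of_injective _ Sum.inl_injective, Set.ncard_compl,
    ← Set.image_univ, Set.ncard_image_of_injective _ hf, Set.ncard_univ, Nat.card_units,
    Nat.card_prod, Nat.card_eq_fintype_card, ← sq]
  have h1 : 1 ≤ Fintype.card F := Fintype.card_pos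
  have h2 : Fintype.card F ≤ Fintype.card F ^ 2 := Nat.le_self_pow two_ne_zero _
  omega

end SigmaFive

/-- The plane `Σ₅` representative has point-orbit distribution
`[2, q−1, q−1, q²−q+1]`. -/
theorem distribution_Sigma5 (F : Type*) [Field F] [Fintype F]
    (hodd : Odd (Fintype.card F)) :
    HasPointOrbitDistribution F
      {M | ∃ a b c : F, M = !![a, 0, c; 0, b, c; c, c, c]}
      2
      (Fintype.card F - 1)
      (Fintype.card F - 1)
      (Fintype.card F ^ 2 - Fintype.card F + 1) := by
  have hrank : ∀ (k : ℕ) (c : F) (M : Matrix (Fin 3) (Fin 3) F), c ≠ 0 → M.rank = k →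
      (c • M).rank = k := fun k c M hc h => by
    rw [rank_smul_of_mem_nonZeroDivisors M (mem_nonZeroDivisors_of_ne_zero hc), h]
  obtain ⟨hsq, hnsq⟩ := two_mul_ncard_units_isSquare_neg hodd
  refine ⟨?_, ?_, ?_, ?_⟩
  · rw [ptsWith_sigmaFive (hrank 1), ncard_sigmaFiveRep_rank_one]
  · rw [ptsWith_sigmaFive fun c M hc h => h.smul hodd hc, ← hsq]
    exact ncard_sigmaFiveRep_rank_two (fun M h => h.rank_eq)
      (fun A M N hA h => exterior_iff_of_congruent hA h)
      (fun s hs => by simpa using exterior_diagonal_iff hodd one_ne_zero hs)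
  · rw [ptsWith_sigmaFive fun c M hc h => h.smul hodd hc, ← hnsq]
    exact ncard_sigmaFiveRep_rank_two (fun M h => h.rank_eq)
      (fun A M N hA h => interior_iff_of_congruent hA h)
      (fun s hs => by simpa using interior_diagonal_iff hodd one_ne_zero hs)
  · rw [ptsWith_sigmaFive (hrank 3), ncard_sigmaFiveRep_rank_three]
end

section
/- Let q be an odd prime power, F = F_q, and let ε ∈ F be a nonsquare. The subspace W₆ = {[[a,b,0],[b,εa,0],[0,0,c]] : a,b,c ∈ F} of Sym₃(F) (a representative of the orbit Σ₆) has point-orbit distribution [1, (q+1)/2, (q+1)/2, q²−1], and every matrix of rank 2 in W₆ lies in the 2-dimensional subspace of W₆ consisting of the matrices with c = 0 (i.e., the rank-2 points of W₆ all lie on a common line). -/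
open Matrix

section PointCount

variable {F : Type*} [Field F]

/-- Counting points of `S` with property `P` by a system of representatives. -/
theorem ptsWith_eq_ncard_s10 {ι : Type*} (S : Set (Matrix (Fin 3) (Fin 3) F))
    (P : Matrix (Fin 3) (Fin 3) F → Prop) (f : ι → Matrix (Fin 3) (Fin 3) F) (T : Set ι)
    (hS : ∀ (k : F), ∀ M ∈ S, k • M ∈ S)
    (hfS : ∀ i ∈ T, f i ∈ S) (hf0 : ∀ i ∈ T, f i ≠ 0)
    (hfP : ∀ i ∈ T, ∃ k : F, k ≠ 0 ∧ P (k • f i))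
    (hinj : ∀ i ∈ T, ∀ j ∈ T, ∀ k : F, k • f i = f j → i = j)
    (hsurj : ∀ M ∈ S, M ≠ 0 → P M → ∃ i ∈ T, ∃ k : F, k • f i = M) :
    ptsWith F S P = T.ncard := by
  have himg : {p : Submodule F (Matrix (Fin 3) (Fin 3) F) |
      ↑p ⊆ S ∧ Module.finrank F ↥p = 1 ∧ ∃ M ∈ p, M ≠ 0 ∧ P M} =
      (fun i => Submodule.span F {f i}) '' T := by
    ext p
    constructor
    · rintro ⟨hpS, hp1, M, hMp, hM0, hPM⟩
      obtain ⟨i, hi, k, rfl⟩ := hsurj M (hpS hMp) hM0 hPM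
      have hk : k ≠ 0 := fun h => hM0 (by simp [h])
      refine ⟨i, hi, ?_⟩
      have : Module.Finite F p := Module.finite_of_finrank_eq_succ hp1
      refine Submodule.eq_of_le_of_finrank_eq ?_ ?_
      · rw [Submodule.span_singleton_le_iff_mem]
        simpa [smul_smul, inv_mul_cancel₀ hk] using p.smul_mem k⁻¹ hMp
      · rw [hp1]
        exact finrank_span_singleton (hf0 i hi)
    · rintro ⟨i, hi, rfl⟩
      refine ⟨?_, finrank_span_singleton (hf0 i hi), ?_⟩
      · intro M hM
        obtain ⟨k, rfl⟩ := Submodule.mem_span_singleton.1 hM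
        exact hS k _ (hfS i hi)
      · obtain ⟨k, hk, hP⟩ := hfP i hi
        exact ⟨k • f i, Submodule.smul_mem _ _ (Submodule.mem_span_singleton_self _),
          smul_ne_zero hk (hf0 i hi), hP⟩
  rw [ptsWith, himg, Set.InjOn.ncard_image]
  intro i hi j hj hij
  have hmem : f j ∈ Submodule.span F {f i} := by
    have := Submodule.mem_span_singleton_self (R := F) (f j)
    simp only at hij
    rwa [hij]
  obtain ⟨k, hk⟩ := Submodule.mem_span_singleton.1 hmem
  exact hinj i hi j hj k hk

end PointCount

section Counting

variable {F : Type*} [Field F] [Fintype F]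

theorem two_ne_zero_of_odd_card (hodd : Odd (Fintype.card F)) : (2 : F) ≠ 0 := by
  apply Ring.two_ne_zero
  intro h
  have := FiniteField.even_card_of_char_two h
  rw [Nat.odd_iff] at hodd
  omega

/-- If `ε` is a nonsquare of a finite field of odd order `q`, then `b ^ 2 - ε` is a square for
exactly `(q - 1) / 2` values of `b`. -/
theorem two_mul_ncard_isSquare_sq_sub (hodd : Odd (Fintype.card F)) (ε : F)
    (hε : ¬ IsSquare ε) :
    2 * {b : F | IsSquare (b ^ 2 - ε)}.ncard + 1 = Fintype.card F := by
  classical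
  have h2 := two_ne_zero_of_odd_card hodd
  have hε0 : ε ≠ 0 := fun h => hε (by simp [h])
  set g : F → F := fun u => (u + ε / u) / 2 with hg
  have hmaps : ∀ u ∈ (Finset.univ.erase (0 : F)),
      g u ∈ Finset.univ.filter (fun b : F => IsSquare (b ^ 2 - ε)) := by
    intro u hu
    have hu0 : u ≠ 0 := Finset.ne_of_mem_erase hu
    rw [Finset.mem_filter]
    refine ⟨Finset.mem_univ _, (u - ε / u) / 2, ?_⟩
    simp only [hg]
    field_simp
    ring
  have hfib : ∀ b ∈ Finset.univ.filter (fun b : F => IsSquare (b ^ 2 - ε)),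
      ((Finset.univ.erase (0 : F)).filter (fun u => g u = b)).card = 2 := by
    intro b hb
    obtain ⟨s, hs⟩ := (Finset.mem_filter.1 hb).2
    have hs0 : s ≠ 0 := by
      rintro rfl
      exact hε ⟨b, by linear_combination -hs⟩
    have hbs : (b + s) * (b - s) = ε := by linear_combination hs
    have hp : b + s ≠ 0 := fun h => hε0 (by rw [← hbs, h, zero_mul])
    have hm : b - s ≠ 0 := fun h => hε0 (by rw [← hbs, h, mul_zero])
    have : (Finset.univ.erase (0 : F)).filter (fun u => g u = b) = {b + s, b - s} := by
      ext u
      simp only [Finset.mem_filter, Finset.mem_erase, Finset.mem_univ, and_true,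
        Finset.mem_insert, Finset.mem_singleton, hg]
      constructor
      · rintro ⟨hu, h⟩
        field_simp at h
        have : (u - (b + s)) * (u - (b - s)) = 0 := by linear_combination h + hbs
        rcases mul_eq_zero.1 this with h | h
        · exact Or.inl (sub_eq_zero.1 h)
        · exact Or.inr (sub_eq_zero.1 h)
      · rintro (rfl | rfl)
        · refine ⟨hp, ?_⟩
          rw [← hbs]
          field_simp
          ring
        · refine ⟨hm, ?_⟩
          rw [← hbs]
          field_simp
          ring
    rw [this, Finset.card_pair]
    intro h
    have : 2 * s = 0 := by linear_combination h
    exact (mul_ne_zero h2 hs0) this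
  have hcard := Finset.card_eq_sum_card_fiberwise hmaps
  rw [Finset.sum_congr rfl hfib, Finset.sum_const, Finset.card_erase_of_mem (Finset.mem_univ _),
    Finset.card_univ, smul_eq_mul] at hcard
  have hset : {b : F | IsSquare (b ^ 2 - ε)}.ncard =
      (Finset.univ.filter (fun b : F => IsSquare (b ^ 2 - ε))).card := by
    rw [← Set.ncard_coe_finset]
    simp
  have := Fintype.card_pos (α := F)
  omega

end Counting

section Plane

variable {F : Type*} [Field F]

/-- The general matrix of the plane `Σ₆`, with coordinates `(a, b, c)`. -/
def planeMatrix (ε : F) (v : F × F × F) : Matrix (Fin 3) (Fin 3) F :=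
  !![v.1, v.2.1, 0; v.2.1, ε * v.1, 0; 0, 0, v.2.2]

theorem smul_planeMatrix (ε k : F) (v : F × F × F) :
    k • planeMatrix ε v = planeMatrix ε (k • v) := by
  ext i j
  fin_cases i <;> fin_cases j <;> simp [planeMatrix, mul_left_comm]

theorem planeMatrix_injective (ε : F) : Function.Injective (planeMatrix ε) := by
  rintro ⟨a, b, c⟩ ⟨a', b', c'⟩ h
  have h00 := congrFun (congrFun h 0) 0
  have h01 := congrFun (congrFun h 0) 1
  have h22 := congrFun (congrFun h 2) 2
  simp [planeMatrix] at h00 h01 h22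
  simp [h00, h01, h22]

theorem planeMatrix_ne_zero {ε : F} {v : F × F × F} (hv : v ≠ 0) : planeMatrix ε v ≠ 0 := by
  intro h
  apply hv
  apply planeMatrix_injective ε
  rw [h]
  ext i j
  fin_cases i <;> fin_cases j <;> simp [planeMatrix]

theorem det_planeMatrix (ε a b c : F) :
    (planeMatrix ε (a, b, c)).det = c * (ε * a ^ 2 - b ^ 2) := by
  simp [planeMatrix, Matrix.det_fin_three]
  ring

/-- Counting the points of the plane `Σ₆` with property `P` by representatives in coordinates. -/
theorem ptsWith_planeMatrix (ε : F) (P : Matrix (Fin 3) (Fin 3) F → Prop) (T : Set (F × F × F))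
    (hT0 : ∀ v ∈ T, v ≠ 0) (hTP : ∀ v ∈ T, ∃ k : F, k ≠ 0 ∧ P (planeMatrix ε (k • v)))
    (hinj : ∀ v ∈ T, ∀ w ∈ T, ∀ k : F, k • v = w → v = w)
    (hsurj : ∀ v, v ≠ 0 → P (planeMatrix ε v) → ∃ w ∈ T, ∃ k : F, k • w = v) :
    ptsWith F {M | ∃ a b c : F, M = !![a, b, 0; b, ε * a, 0; 0, 0, c]} P = T.ncard := by
  apply ptsWith_eq_ncard_s10 _ P (planeMatrix ε) T
  · rintro k _ ⟨a, b, c, rfl⟩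
    exact ⟨k * a, k * b, k * c, smul_planeMatrix ε k (a, b, c)⟩
  · exact fun v _ => ⟨v.1, v.2.1, v.2.2, rfl⟩
  · exact fun v hv => planeMatrix_ne_zero (hT0 v hv)
  · intro v hv
    simpa only [smul_planeMatrix] using hTP v hv
  · intro v hv w hw k h
    rw [smul_planeMatrix] at h
    exact hinj v hv w hw k (planeMatrix_injective ε h)
  · rintro _ ⟨a, b, c, rfl⟩ hM hP
    obtain ⟨w, hw, k, hk⟩ := hsurj (a, b, c) (by
      rintro h
      obtain ⟨rfl, rfl, rfl⟩ : a = 0 ∧ b = 0 ∧ c = 0 := by simpa using h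
      apply hM
      ext i j
      fin_cases i <;> fin_cases j <;> simp) hP
    exact ⟨w, hw, k, by rw [smul_planeMatrix, hk]; rfl⟩

theorem eq_zero_of_norm_eq_zero {ε : F} (hε : ¬ IsSquare ε) {a b : F}
    (h : ε * a ^ 2 - b ^ 2 = 0) : a = 0 ∧ b = 0 := by
  by_cases ha : a = 0
  · subst ha
    simpa using h
  · exact absurd ⟨b / a, by field_simp; linear_combination h⟩ hε

theorem rank_eq_three_iff (M : Matrix (Fin 3) (Fin 3) F) : M.rank = 3 ↔ M.det ≠ 0 := by
  rw [← isUnit_iff_ne_zero, ← Matrix.isUnit_iff_isUnit_det]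
  constructor
  · intro h
    rw [← Matrix.linearIndependent_rows_iff_isUnit, linearIndependent_iff_card_eq_finrank_span,
      Set.finrank, ← Matrix.rank_eq_finrank_span_row, h]
    simp
  · intro h
    simpa using Matrix.rank_of_isUnit M h

theorem rank_planeMatrix_zero_zero (ε : F) {c : F} (hc : c ≠ 0) :
    (planeMatrix ε (0, 0, c)).rank = 1 := by
  classical
  have : planeMatrix ε (0, 0, c) = Matrix.diagonal ![0, 0, c] := by
    ext i j
    fin_cases i <;> fin_cases j <;> simp [planeMatrix]
  rw [this, Matrix.rank_diagonal, Fintype.card_eq_one_iff]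
  refine ⟨⟨2, by simpa⟩, ?_⟩
  rintro ⟨i, hi⟩
  fin_cases i <;> simp at hi ⊢

theorem two_le_rank_planeMatrix {ε : F} (hε : ¬ IsSquare ε) {a b : F} (hab : (a, b) ≠ 0) (c : F) :
    2 ≤ (planeMatrix ε (a, b, c)).rank := by
  have hdet : IsUnit (!![a, b; b, ε * a] : Matrix (Fin 2) (Fin 2) F) := by
    rw [Matrix.isUnit_iff_isUnit_det, isUnit_iff_ne_zero, Matrix.det_fin_two_of]
    intro h
    obtain ⟨rfl, rfl⟩ := eq_zero_of_norm_eq_zero hε (a := a) (b := b) (by linear_combination h)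
    exact hab rfl
  have hrank := Matrix.rank_of_isUnit _ hdet
  have heq : (!![a, b; b, ε * a] : Matrix (Fin 2) (Fin 2) F) =
      (!![1, 0, 0; 0, 1, 0] : Matrix (Fin 2) (Fin 3) F) *
        (planeMatrix ε (a, b, c) * (!![1, 0; 0, 1; 0, 0] : Matrix (Fin 3) (Fin 2) F)) := by
    ext i j
    fin_cases i <;> fin_cases j <;> simp [planeMatrix, Matrix.mul_apply, Fin.sum_univ_three]
  rw [heq] at hrank
  have h1 := Matrix.rank_mul_le_right (!![1, 0, 0; 0, 1, 0] : Matrix (Fin 2) (Fin 3) F)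
    (planeMatrix ε (a, b, c) * (!![1, 0; 0, 1; 0, 0] : Matrix (Fin 3) (Fin 2) F))
  have h2 := Matrix.rank_mul_le_left (planeMatrix ε (a, b, c))
    (!![1, 0; 0, 1; 0, 0] : Matrix (Fin 3) (Fin 2) F)
  rw [Fintype.card_fin] at hrank
  omega

/-- A matrix of `Σ₆` congruent to `diag(1, -δ, 0)` with `δ ≠ 0` has `c = 0`, and its discriminant
is `δ` up to a nonzero square. -/
theorem eq_zero_and_disc_of_congr {ε : F} (hε : ¬ IsSquare ε) {a b c δ : F} (hδ : δ ≠ 0)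
    {A : Matrix (Fin 3) (Fin 3) F} (hA : IsUnit A)
    (h : A * planeMatrix ε (a, b, c) * A.transpose = Matrix.diagonal ![1, -δ, 0]) :
    c = 0 ∧ ∃ t : F, t ^ 2 * (b ^ 2 - ε * a ^ 2) = δ := by
  have hdetA : A.det ≠ 0 := ((Matrix.isUnit_iff_isUnit_det A).1 hA).ne_zero
  have hdet := congrArg Matrix.det h
  rw [Matrix.det_mul, Matrix.det_mul, Matrix.det_transpose, det_planeMatrix,
    Matrix.det_diagonal] at hdet
  simp [Fin.prod_univ_three, hdetA] at hdet
  have h00 := congrFun (congrFun h 0) 0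
  have h01 := congrFun (congrFun h 0) 1
  have h10 := congrFun (congrFun h 1) 0
  have h11 := congrFun (congrFun h 1) 1
  simp [planeMatrix, Matrix.mul_apply, Fin.sum_univ_three]
    at h00 h01 h10 h11
  have hc : c = 0 := by
    by_contra hc
    obtain ⟨rfl, rfl⟩ := eq_zero_of_norm_eq_zero hε (hdet.resolve_left hc)
    apply hδ
    simp at h00 h01 h10 h11
    grind
  subst hc
  refine ⟨rfl, A 0 0 * A 1 1 - A 0 1 * A 1 0, ?_⟩
  grind

theorem eq_zero_and_isSquare_of_exterior {ε : F} (hε : ¬ IsSquare ε) {a b c : F}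
    (h : Exterior (planeMatrix ε (a, b, c))) : c = 0 ∧ IsSquare (b ^ 2 - ε * a ^ 2) := by
  obtain ⟨A, hA, h⟩ := h
  obtain ⟨hc, t, ht⟩ := eq_zero_and_disc_of_congr hε one_ne_zero hA h
  have ht0 : t ≠ 0 := by rintro rfl; simp at ht
  exact ⟨hc, t⁻¹, by field_simp; linear_combination ht⟩

theorem eq_zero_and_not_isSquare_of_interior {ε : F} (hε : ¬ IsSquare ε) {a b c : F}
    (h : Interior (planeMatrix ε (a, b, c))) : c = 0 ∧ ¬ IsSquare (b ^ 2 - ε * a ^ 2) := by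
  obtain ⟨A, δ, hA, hδ, h⟩ := h
  obtain ⟨hc, t, ht⟩ := eq_zero_and_disc_of_congr hε (fun h => hδ (by simp [h])) hA h
  refine ⟨hc, ?_⟩
  rintro ⟨s, hs⟩
  exact hδ ⟨t * s, by rw [← ht, hs]; ring⟩

theorem congr_planeMatrix_one (ε b t : F) :
    !![1, 0, 0; -(t * b), t, 0; 0, 0, 1] * planeMatrix ε (1, b, 0) *
      (!![1, 0, 0; -(t * b), t, 0; 0, 0, 1] : Matrix (Fin 3) (Fin 3) F).transpose =
      Matrix.diagonal ![1, -(t ^ 2 * (b ^ 2 - ε)), 0] := by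
  ext i j
  fin_cases i <;> fin_cases j <;>
    simp [planeMatrix, Matrix.mul_apply, Fin.sum_univ_three] <;> ring

theorem isUnit_lowerTriangular (b : F) {t : F} (ht : t ≠ 0) :
    IsUnit (!![1, 0, 0; b, t, 0; 0, 0, 1] : Matrix (Fin 3) (Fin 3) F) := by
  rw [Matrix.isUnit_iff_isUnit_det, isUnit_iff_ne_zero]
  simpa [Matrix.det_fin_three] using ht

theorem exterior_planeMatrix_one {ε b : F} (hε : ¬ IsSquare ε) (h : IsSquare (b ^ 2 - ε)) :
    Exterior (planeMatrix ε (1, b, 0)) := by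
  obtain ⟨s, hs⟩ := h
  have hs0 : s ≠ 0 := by
    rintro rfl
    exact hε ⟨b, by linear_combination -hs⟩
  refine ⟨_, isUnit_lowerTriangular _ (inv_ne_zero hs0),
    (congr_planeMatrix_one ε b s⁻¹).trans ?_⟩
  rw [hs]
  field_simp

theorem interior_planeMatrix_one {ε b : F} (h : ¬ IsSquare (b ^ 2 - ε)) :
    Interior (planeMatrix ε (1, b, 0)) := by
  refine ⟨_, b ^ 2 - ε, isUnit_lowerTriangular _ one_ne_zero, h,
    (congr_planeMatrix_one ε b 1).trans ?_⟩
  simp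

theorem exterior_planeMatrix_zero_one (ε : F) (h2 : (2 : F) ≠ 0) :
    Exterior (planeMatrix ε (0, 1, 0)) := by
  refine ⟨!![1, 1 / 2, 0; 1, -(1 / 2), 0; 0, 0, 1], ?_, ?_⟩
  · rw [Matrix.isUnit_iff_isUnit_det, isUnit_iff_ne_zero]
    simp [Matrix.det_fin_three]
    field_simp
    norm_num [h2]
  · ext i j
    fin_cases i <;> fin_cases j <;>
      simp [planeMatrix, Matrix.mul_apply, Fin.sum_univ_three] <;>
      field_simp <;> norm_num

end Plane

/-- The plane `Σ₆` representative has point-orbit distribution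
`[1, (q+1)/2, (q+1)/2, q²−1]`, and all its rank-2 matrices lie in the 2-dimensional
subspace of matrices with `c = 0`. -/
theorem distribution_Sigma6 (F : Type*) [Field F] [Fintype F]
    (hodd : Odd (Fintype.card F)) (ε : F) (hε : ¬ IsSquare ε) :
    HasPointOrbitDistribution F
      {M | ∃ a b c : F, M = !![a, b, 0; b, ε * a, 0; 0, 0, c]}
      1
      ((Fintype.card F + 1) / 2)
      ((Fintype.card F + 1) / 2)
      (Fintype.card F ^ 2 - 1) ∧
    ∀ M ∈ {M : Matrix (Fin 3) (Fin 3) F | ∃ a b c : F, M = !![a, b, 0; b, ε * a, 0; 0, 0, c]},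
      M.rank = 2 → ∃ a b : F, M = !![a, b, 0; b, ε * a, 0; 0, 0, 0] := by
  have h2 := two_ne_zero_of_odd_card hodd
  have hsq := two_mul_ncard_isSquare_sq_sub hodd ε hε
  have hinj1 : Function.Injective (fun b : F => ((1 : F), b, (0 : F))) :=
    fun b b' h => by simpa using h
  refine ⟨⟨?_, ?_, ?_, ?_⟩, ?_⟩
  · rw [ptsWith_planeMatrix ε _ {(0, 0, 1)}, Set.ncard_singleton]
    · simp
    · rintro _ rfl
      exact ⟨1, one_ne_zero, by simpa using rank_planeMatrix_zero_zero ε (one_ne_zero (α := F))⟩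
    · rintro _ rfl _ rfl k -
      rfl
    · rintro ⟨a, b, c⟩ - h
      have hab : (a, b) = 0 := by
        by_contra hab
        have := two_le_rank_planeMatrix hε hab c
        omega
      exact ⟨_, rfl, c, by simp_all⟩
  · rw [ptsWith_planeMatrix ε _
      (insert (0, 1, 0) ((fun b : F => (1, b, 0)) '' {b : F | IsSquare (b ^ 2 - ε)})),
      Set.ncard_insert_of_notMem (by simp), Set.ncard_image_of_injective _ hinj1]
    · omega
    · rintro _ (rfl | ⟨b, -, rfl⟩) <;> simp
    · rintro _ (rfl | ⟨b, hb, rfl⟩)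
      · exact ⟨1, one_ne_zero, by simpa using exterior_planeMatrix_zero_one ε h2⟩
      · exact ⟨1, one_ne_zero, by simpa using exterior_planeMatrix_one hε hb⟩
    · rintro _ (rfl | ⟨b, -, rfl⟩) _ (rfl | ⟨b', -, rfl⟩) k h <;> simp at h ⊢
      · simp [h] at h
      · simpa [h.1] using h
    · rintro ⟨a, b, c⟩ - h
      obtain ⟨rfl, s, hs⟩ := eq_zero_and_isSquare_of_exterior hε h
      by_cases ha : a = 0
      · exact ⟨_, Set.mem_insert _ _, b, by simp [ha]⟩
      · refine ⟨_, Set.mem_insert_of_mem _ ⟨b / a, ⟨s / a, ?_⟩, rfl⟩, a, ?_⟩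
        · field_simp
          linear_combination hs
        · simp [mul_div_cancel₀ _ ha]
  · rw [ptsWith_planeMatrix ε _ ((fun b : F => (1, b, 0)) '' {b : F | IsSquare (b ^ 2 - ε)}ᶜ),
      Set.ncard_image_of_injective _ hinj1]
    · have := Set.ncard_add_ncard_compl {b : F | IsSquare (b ^ 2 - ε)}
      rw [Nat.card_eq_fintype_card] at this
      omega
    · rintro _ ⟨b, -, rfl⟩
      simp
    · rintro _ ⟨b, hb, rfl⟩
      exact ⟨1, one_ne_zero, by simpa using interior_planeMatrix_one hb⟩
    · rintro _ ⟨b, -, rfl⟩ _ ⟨b', -, rfl⟩ k h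
      simp at h ⊢
      simpa [h.1] using h
    · rintro ⟨a, b, c⟩ - h
      obtain ⟨rfl, hs⟩ := eq_zero_and_not_isSquare_of_interior hε h
      have ha : a ≠ 0 := by
        rintro rfl
        exact hs ⟨b, by ring⟩
      refine ⟨_, ⟨b / a, ?_, rfl⟩, a, ?_⟩
      · rintro ⟨s, h⟩
        refine hs ⟨s * a, ?_⟩
        field_simp at h
        linear_combination h
      · simp [mul_div_cancel₀ _ ha]
  · have hinj2 : Function.Injective (fun v : F × F => (v.1, v.2, (1 : F))) := by
      rintro ⟨a, b⟩ ⟨a', b'⟩ h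
      simpa using h
    rw [ptsWith_planeMatrix ε _ ((fun v : F × F => (v.1, v.2, 1)) '' {0}ᶜ),
      Set.ncard_image_of_injective _ hinj2]
    · rw [Set.ncard_compl, Set.ncard_singleton, Nat.card_eq_fintype_card, Fintype.card_prod, sq]
    · rintro _ ⟨v, -, rfl⟩
      simp
    · rintro _ ⟨⟨a, b⟩, hv, rfl⟩
      refine ⟨1, one_ne_zero, ?_⟩
      rw [one_smul, rank_eq_three_iff, det_planeMatrix, one_mul]
      intro h
      obtain ⟨rfl, rfl⟩ := eq_zero_of_norm_eq_zero hε h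
      exact hv rfl
    · rintro _ ⟨v, -, rfl⟩ _ ⟨w, -, rfl⟩ k h
      simp at h ⊢
      simpa [h.2.2] using h
    · rintro ⟨a, b, c⟩ - h
      rw [rank_eq_three_iff, det_planeMatrix] at h
      have hc : c ≠ 0 := left_ne_zero_of_mul h
      refine ⟨_, ⟨(a / c, b / c), ?_, rfl⟩, c, ?_⟩
      · intro h0
        obtain ⟨rfl, rfl⟩ : a = 0 ∧ b = 0 := by simpa [hc] using h0
        simp at h
      · simp [mul_div_cancel₀ _ hc]
  · rintro _ ⟨a, b, c, rfl⟩ hr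
    change (planeMatrix ε (a, b, c)).rank = 2 at hr
    obtain rfl : c = 0 := by
      by_contra hc
      have hdet : (planeMatrix ε (a, b, c)).det = 0 := by
        by_contra h
        rw [← ne_eq, ← rank_eq_three_iff] at h
        omega
      rw [det_planeMatrix] at hdet
      obtain ⟨rfl, rfl⟩ := eq_zero_of_norm_eq_zero hε ((mul_eq_zero.1 hdet).resolve_left hc)
      have := rank_planeMatrix_zero_zero ε hc
      omega
    exact ⟨a, b, rfl⟩
end

section
/- Let q be an odd prime power and F = F_q. The subspace W₇ = {[[a,b,c],[b,0,0],[c,0,0]] : a,b,c ∈ F} of Sym₃(F) (a representative of the orbit Σ₇, a tangent plane of the quadric Veronesean) has point-orbit distribution [1, q²+q, 0, 0]; in particular it contains no matrix of rank 3 and every rank-2 point in it is exterior. -/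
open Matrix

/-- The symmetric matrices of the tangent plane of the quadric Veronesean at `diag(1, 0, 0)`. -/
def tangentMatrix {F : Type*} [Field F] (a b c : F) : Matrix (Fin 3) (Fin 3) F :=
  !![a, b, c; b, 0, 0; c, 0, 0]

section TangentPlane

variable {F : Type*} [Field F]

lemma tangentMatrix_inj {a b c a' b' c' : F} :
    tangentMatrix a b c = tangentMatrix a' b' c' ↔ a = a' ∧ b = b' ∧ c = c' := by
  constructor
  · intro h
    exact ⟨congrFun₂ h 0 0, congrFun₂ h 0 1, congrFun₂ h 0 2⟩
  · rintro ⟨rfl, rfl, rfl⟩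
    rfl

lemma smul_tangentMatrix (r a b c : F) :
    r • tangentMatrix a b c = tangentMatrix (r * a) (r * b) (r * c) := by
  ext i j
  fin_cases i <;> fin_cases j <;> simp [tangentMatrix]

lemma tangentMatrix_eq_zero_iff {a b c : F} :
    tangentMatrix a b c = 0 ↔ a = 0 ∧ b = 0 ∧ c = 0 := by
  rw [← tangentMatrix_inj, ← zero_smul F (tangentMatrix 0 0 0), smul_tangentMatrix, zero_mul]

/-- The discriminant of the leading binary form of any matrix congruent to a matrix of the
tangent plane is a square. -/
lemma exists_sq_eq_of_congr_tangentMatrix {a b c ε : F} {A : Matrix (Fin 3) (Fin 3) F}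
    (h : A * tangentMatrix a b c * Aᵀ = diagonal ![1, -ε, 0]) :
    ε = (A 0 0 * (b * A 1 1 + c * A 1 2) - A 1 0 * (b * A 0 1 + c * A 0 2)) ^ 2 := by
  have h00 := congrFun₂ h 0 0
  have h01 := congrFun₂ h 0 1
  have h11 := congrFun₂ h 1 1
  simp [tangentMatrix, Matrix.mul_apply, Fin.sum_univ_three] at h00 h01 h11
  grind

lemma not_interior_tangentMatrix (a b c : F) : ¬ Interior (tangentMatrix a b c) := by
  rintro ⟨A, ε, -, hε, h⟩
  exact hε ((isSquare_iff_exists_sq ε).2 ⟨_, exists_sq_eq_of_congr_tangentMatrix h⟩)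

lemma exterior_tangentMatrix_iff (h2 : (2 : F) ≠ 0) {a b c : F} :
    Exterior (tangentMatrix a b c) ↔ b ≠ 0 ∨ c ≠ 0 := by
  constructor
  · rintro ⟨A, -, h⟩
    by_contra! hbc
    have := exists_sq_eq_of_congr_tangentMatrix h
    simp [hbc] at this
  · intro hbc
    obtain ⟨s, t, hst⟩ : ∃ s t : F, b * s + c * t = 1 := by
      rcases hbc with hb | hc
      · exact ⟨b⁻¹, 0, by simp [hb]⟩
      · exact ⟨0, c⁻¹, by simp [hc]⟩
    obtain ⟨u, hu⟩ : ∃ u : F, 2 * u = 1 - a := ⟨(1 - a) / 2, by field_simp⟩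
    refine ⟨!![1, u * s, u * t; 1, (u - 1) * s, (u - 1) * t; 0, c, -b], ?_, ?_⟩
    · rw [Matrix.isUnit_iff_isUnit_det, Matrix.det_fin_three]
      convert isUnit_one (M := F) using 1
      simp
      linear_combination hst
    · ext i j
      fin_cases i <;> fin_cases j <;>
        simp [tangentMatrix, Matrix.mul_apply, Fin.sum_univ_three] <;> grind

lemma Exterior.rank_eq_two {M : Matrix (Fin 3) (Fin 3) F} (h : Exterior M) : M.rank = 2 := by
  classical
  obtain ⟨A, hA, h⟩ := h
  have hA' : IsUnit A.det := (Matrix.isUnit_iff_isUnit_det A).1 hA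
  have hr := congrArg Matrix.rank h
  rw [Matrix.rank_mul_eq_left_of_isUnit_det _ _ (by rwa [Matrix.det_transpose]),
    Matrix.rank_mul_eq_right_of_isUnit_det _ _ hA', Matrix.rank_diagonal,
    Fintype.card_subtype] at hr
  rw [hr, Finset.card_filter, Fin.sum_univ_three]
  simp

lemma rank_tangentMatrix_ne_three (a b c : F) : (tangentMatrix a b c).rank ≠ 3 := by
  intro h
  have hu : IsUnit (tangentMatrix a b c) := by
    rw [← Matrix.linearIndependent_rows_iff_isUnit, linearIndependent_iff_card_eq_finrank_span,
      Set.finrank, ← Matrix.rank_eq_finrank_span_row, h, Fintype.card_fin]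
  rw [Matrix.isUnit_iff_isUnit_det, Matrix.det_fin_three] at hu
  simp [tangentMatrix] at hu

lemma rank_tangentMatrix_zero_zero_le (a : F) : (tangentMatrix a 0 0).rank ≤ 1 := by
  have : tangentMatrix a 0 0 = vecMulVec ![a, 0, 0] ![1, 0, 0] := by
    ext i j
    fin_cases i <;> fin_cases j <;> simp [tangentMatrix, vecMulVec_apply]
  rw [this]
  exact Matrix.rank_vecMulVec_le _ _

lemma exterior_tangentMatrix_of_rank_eq_two (h2 : (2 : F) ≠ 0) {a b c : F}
    (h : (tangentMatrix a b c).rank = 2) : Exterior (tangentMatrix a b c) := by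
  rw [exterior_tangentMatrix_iff h2]
  by_contra! hbc
  obtain ⟨rfl, rfl⟩ := hbc
  have := rank_tangentMatrix_zero_zero_le a
  omega

lemma rank_tangentMatrix_eq_one_iff (h2 : (2 : F) ≠ 0) {a b c : F} :
    (tangentMatrix a b c).rank = 1 ↔ a ≠ 0 ∧ b = 0 ∧ c = 0 := by
  constructor
  · intro h
    have hbc : ¬ (b ≠ 0 ∨ c ≠ 0) := fun hbc => by
      have := ((exterior_tangentMatrix_iff h2 (a := a)).2 hbc).rank_eq_two
      omega
    push Not at hbc
    refine ⟨?_, hbc⟩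
    rintro rfl
    rw [tangentMatrix_eq_zero_iff.2 ⟨rfl, hbc⟩, Matrix.rank_zero] at h
    omega
  · rintro ⟨ha, rfl, rfl⟩
    refine le_antisymm (rank_tangentMatrix_zero_zero_le a) (Nat.one_le_iff_ne_zero.2 fun h => ?_)
    rw [Matrix.rank, Submodule.finrank_eq_zero, LinearMap.range_eq_bot] at h
    have h00 := congrFun (LinearMap.congr_fun h ![1, 0, 0]) 0
    exact ha (by simpa [tangentMatrix] using h00)

lemma span_tangentMatrix_le_iff {a b c a' b' c' : F} :
    F ∙ tangentMatrix a b c ≤ F ∙ tangentMatrix a' b' c' ↔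
      ∃ r : F, r * a' = a ∧ r * b' = b ∧ r * c' = c := by
  simp_rw [Submodule.span_singleton_le_iff_mem, Submodule.mem_span_singleton, smul_tangentMatrix,
    tangentMatrix_inj]

/-- The points of the tangent plane are the spans of its nonzero matrices. -/
lemma ptsWith_tangentPlane (P : Matrix (Fin 3) (Fin 3) F → Prop) :
    ptsWith F {M | ∃ a b c : F, M = !![a, b, c; b, 0, 0; c, 0, 0]} P =
      Set.ncard {p : Submodule F (Matrix (Fin 3) (Fin 3) F) | ∃ a b c : F,
        tangentMatrix a b c ≠ 0 ∧ P (tangentMatrix a b c) ∧ F ∙ tangentMatrix a b c = p} := by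
  unfold ptsWith
  congr 1
  ext p
  constructor
  · rintro ⟨hS, hp, M, hM, h0, hP⟩
    obtain ⟨a, b, c, rfl⟩ := hS hM
    refine ⟨a, b, c, h0, hP, Submodule.eq_of_le_of_finrank_eq ?_ ?_⟩
    · rwa [Submodule.span_singleton_le_iff_mem]
    · rw [hp]
      exact finrank_span_singleton h0
  · rintro ⟨a, b, c, h0, hP, rfl⟩
    refine ⟨fun M hM => ?_, finrank_span_singleton h0, _, Submodule.mem_span_singleton_self _,
      h0, hP⟩
    obtain ⟨r, rfl⟩ := Submodule.mem_span_singleton.1 hM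
    exact ⟨r * a, r * b, r * c, smul_tangentMatrix r a b c⟩

lemma ptsWith_tangentPlane_eq_zero {P : Matrix (Fin 3) (Fin 3) F → Prop}
    (hP : ∀ a b c, ¬ P (tangentMatrix a b c)) :
    ptsWith F {M | ∃ a b c : F, M = !![a, b, c; b, 0, 0; c, 0, 0]} P = 0 := by
  rw [ptsWith_tangentPlane]
  simp [hP]

lemma ptsWith_tangentPlane_rank_one (h2 : (2 : F) ≠ 0) :
    ptsWith F {M | ∃ a b c : F, M = !![a, b, c; b, 0, 0; c, 0, 0]}
      (fun M => M.rank = 1) = 1 := by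
  rw [ptsWith_tangentPlane, Set.ncard_eq_one]
  refine ⟨F ∙ tangentMatrix 1 0 0, Set.ext fun p => ?_⟩
  simp only [Set.mem_ofPred_eq, Set.mem_singleton_iff, rank_tangentMatrix_eq_one_iff h2]
  constructor
  · rintro ⟨a, b, c, -, ⟨ha, rfl, rfl⟩, rfl⟩
    exact le_antisymm (span_tangentMatrix_le_iff.2 ⟨a, by simp⟩)
      (span_tangentMatrix_le_iff.2 ⟨a⁻¹, by simp [ha]⟩)
  · rintro rfl
    exact ⟨1, 0, 0, by simp [tangentMatrix_eq_zero_iff], by simp, rfl⟩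

/-- The points of the tangent plane off `diag(1, 0, 0)`, by normalized coordinates. -/
def tangentPoint : (F × F) ⊕ F → Submodule F (Matrix (Fin 3) (Fin 3) F)
  | .inl (a, c) => F ∙ tangentMatrix a 1 c
  | .inr a => F ∙ tangentMatrix a 0 1

lemma tangentPoint_injective : Function.Injective (tangentPoint (F := F)) := by
  rintro (⟨a, c⟩ | a) (⟨a', c'⟩ | a') h <;>
    obtain ⟨r, h₁, h₂, h₃⟩ := span_tangentMatrix_le_iff.1 (le_of_eq h) <;> grind

lemma ptsWith_tangentPlane_exterior [Fintype F] (h2 : (2 : F) ≠ 0) :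
    ptsWith F {M | ∃ a b c : F, M = !![a, b, c; b, 0, 0; c, 0, 0]} Exterior =
      Fintype.card F ^ 2 + Fintype.card F := by
  have hrange : {p : Submodule F (Matrix (Fin 3) (Fin 3) F) | ∃ a b c : F,
      tangentMatrix a b c ≠ 0 ∧ Exterior (tangentMatrix a b c) ∧ F ∙ tangentMatrix a b c = p} =
      Set.range tangentPoint := by
    ext p
    simp only [Set.mem_ofPred_eq, Set.mem_range, exterior_tangentMatrix_iff h2]
    constructor
    · rintro ⟨a, b, c, -, hbc, rfl⟩
      by_cases hb : b = 0
      · subst hb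
        have hc : c ≠ 0 := by simpa using hbc
        refine ⟨.inr (c⁻¹ * a), le_antisymm (span_tangentMatrix_le_iff.2 ⟨c⁻¹, by simp [hc]⟩)
          (span_tangentMatrix_le_iff.2 ⟨c, by simp [hc]⟩)⟩
      · refine ⟨.inl (b⁻¹ * a, b⁻¹ * c),
          le_antisymm (span_tangentMatrix_le_iff.2 ⟨b⁻¹, by simp [hb]⟩)
          (span_tangentMatrix_le_iff.2 ⟨b, by simp [hb]⟩)⟩
    · rintro ⟨⟨a, c⟩ | a, rfl⟩
      · exact ⟨a, 1, c, by simp [tangentMatrix_eq_zero_iff], by simp, rfl⟩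
      · exact ⟨a, 0, 1, by simp [tangentMatrix_eq_zero_iff], by simp, rfl⟩
  rw [ptsWith_tangentPlane, hrange, ← Nat.card_coe_set_eq,
    Nat.card_range_of_injective tangentPoint_injective, Nat.card_eq_fintype_card,
    Fintype.card_sum, Fintype.card_prod, sq]

end TangentPlane

/-- The plane `Σ₇` representative (a tangent plane of the quadric Veronesean) has
point-orbit distribution `[1, q²+q, 0, 0]`; in particular it contains no matrix of rank 3
and every rank-2 matrix in it is exterior. -/
theorem distribution_Sigma7 (F : Type*) [Field F] [Fintype F]
    (hodd : Odd (Fintype.card F)) :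
    HasPointOrbitDistribution F
      {M | ∃ a b c : F, M = !![a, b, c; b, 0, 0; c, 0, 0]}
      1
      (Fintype.card F ^ 2 + Fintype.card F)
      0
      0 ∧
    (∀ M ∈ {M : Matrix (Fin 3) (Fin 3) F | ∃ a b c : F, M = !![a, b, c; b, 0, 0; c, 0, 0]},
      M.rank ≠ 3) ∧
    (∀ M ∈ {M : Matrix (Fin 3) (Fin 3) F | ∃ a b c : F, M = !![a, b, c; b, 0, 0; c, 0, 0]},
      M.rank = 2 → Exterior M) := by
  have h2 : (2 : F) ≠ 0 := by
    refine Ring.two_ne_zero fun h => ?_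
    have := FiniteField.even_card_iff_char_two.1 h
    rw [Nat.odd_iff] at hodd
    omega
  refine ⟨⟨ptsWith_tangentPlane_rank_one h2, ptsWith_tangentPlane_exterior h2,
    ptsWith_tangentPlane_eq_zero not_interior_tangentMatrix,
    ptsWith_tangentPlane_eq_zero rank_tangentMatrix_ne_three⟩, ?_, ?_⟩
  · rintro _ ⟨a, b, c, rfl⟩
    exact rank_tangentMatrix_ne_three a b c
  · rintro _ ⟨a, b, c, rfl⟩
    exact exterior_tangentMatrix_of_rank_eq_two h2
end

section
/- Let q be an odd prime power and F = F_q. The subspace W₈ = {[[a,b,0],[b,0,c],[0,c,0]] : a,b,c ∈ F} of Sym₃(F) (a representative of the orbit Σ₈) has point-orbit distribution [1, 2q, 0, q²−q]. -/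
open Matrix

theorem ptsWith_eq_card {F ι : Type*} [Field F] {S : Set (Matrix (Fin 3) (Fin 3) F)}
    {P : Matrix (Fin 3) (Fin 3) F → Prop} (f : ι → Matrix (Fin 3) (Fin 3) F)
    (hsmul : ∀ (t : F), ∀ M ∈ S, t • M ∈ S) (hmem : ∀ i, f i ∈ S) (hne : ∀ i, f i ≠ 0)
    (hP : ∀ i, P (f i)) (hinj : ∀ i j (t : F), t • f i = f j → i = j)
    (hsurj : ∀ M ∈ S, M ≠ 0 → P M → ∃ i, ∃ t : F, t • f i = M) :
    ptsWith F S P = Nat.card ι := by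
  have hspan : Function.Injective fun i => Submodule.span F {f i} := by
    intro i j hij
    have hj : f j ∈ Submodule.span F {f i} := by
      simpa only [hij] using Submodule.mem_span_singleton_self (f j)
    obtain ⟨t, ht⟩ := Submodule.mem_span_singleton.1 hj
    exact hinj i j t ht
  rw [ptsWith, ← Set.ncard_range_of_injective hspan]
  congr 1
  ext p
  constructor
  · rintro ⟨hpS, hp, M, hMp, hM, hPM⟩
    obtain ⟨i, t, rfl⟩ := hsurj M (hpS hMp) hM hPM
    have ht : t ≠ 0 := by
      rintro rfl
      simp at hM
    have hfp : f i ∈ p := (p.smul_mem_iff ht).1 hMp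
    have : FiniteDimensional F p := Module.finite_of_finrank_eq_succ hp
    refine ⟨i, Submodule.eq_of_le_of_finrank_eq ?_ ?_⟩
    · rwa [Submodule.span_singleton_le_iff_mem]
    · rw [finrank_span_singleton (hne i), hp]
  · rintro ⟨i, rfl⟩
    refine ⟨?_, finrank_span_singleton (hne i), f i, Submodule.mem_span_singleton_self _,
      hne i, hP i⟩
    intro M hM
    obtain ⟨t, rfl⟩ := Submodule.mem_span_singleton.1 hM
    exact hsmul t _ (hmem i)

theorem Matrix.rank_eq_card_iff_det_ne_zero {F n : Type*} [Field F] [Fintype n] [DecidableEq n]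
    (M : Matrix n n F) : M.rank = Fintype.card n ↔ M.det ≠ 0 := by
  rw [← isUnit_iff_ne_zero, ← isUnit_iff_isUnit_det]
  refine ⟨fun h => ?_, M.rank_of_isUnit⟩
  rw [← linearIndependent_rows_iff_isUnit, linearIndependent_iff_card_eq_finrank_span, ← h,
    rank_eq_finrank_span_row, Set.finrank]

theorem Matrix.two_le_rank_of_minor_ne_zero {F m n : Type*} [Field F] [Fintype m] [Fintype n]
    (M : Matrix m n F) (r : Fin 2 → m) (c : Fin 2 → n)
    (h : (M.submatrix r c).det ≠ 0) : 2 ≤ M.rank := by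
  have h2 := (rank_eq_card_iff_det_ne_zero _).2 h
  rw [Fintype.card_fin] at h2
  exact h2 ▸ M.rank_submatrix_le r c

theorem rank_single_corner {F : Type*} [Field F] {a : F} (ha : a ≠ 0) :
    (!![a, 0, 0; 0, 0, 0; 0, 0, 0] : Matrix (Fin 3) (Fin 3) F).rank = 1 := by
  classical
  have h : (!![a, 0, 0; 0, 0, 0; 0, 0, 0] : Matrix (Fin 3) (Fin 3) F)
      = diagonal ![a, 0, 0] := by
    ext i j
    fin_cases i <;> fin_cases j <;> simp
  rw [h, rank_diagonal, Fintype.card_eq_one_iff]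
  refine ⟨⟨0, by simpa using ha⟩, ?_⟩
  rintro ⟨i, hi⟩
  fin_cases i <;> simp at hi ⊢

theorem eq_zero_of_rank_one_congr_diagonal {F : Type*} [Field F] {a d : F}
    {A : Matrix (Fin 3) (Fin 3) F}
    (h : A * !![a, 0, 0; 0, 0, 0; 0, 0, 0] * Aᵀ = diagonal ![1, d, 0]) : d = 0 := by
  have h00 := congrFun₂ h 0 0
  have h01 := congrFun₂ h 0 1
  have h11 := congrFun₂ h 1 1
  simp [Matrix.mul_apply, Fin.sum_univ_three] at h00 h01 h11
  grind

theorem Interior.mulVec_eq_zero {F : Type*} [Field F] {M : Matrix (Fin 3) (Fin 3) F}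
    (hM : Interior M) {v : Fin 3 → F} (hv : v ⬝ᵥ M *ᵥ v = 0) : M *ᵥ v = 0 := by
  obtain ⟨A, ε, hA, hε, h⟩ := hM
  have hAdet := (isUnit_iff_isUnit_det A).1 hA
  obtain ⟨w, rfl⟩ : ∃ w, Aᵀ *ᵥ w = v :=
    ⟨Aᵀ⁻¹ *ᵥ v, by
      rw [mulVec_mulVec, mul_nonsing_inv _ (by rwa [det_transpose]), one_mulVec]⟩
  have hD : A *ᵥ (M *ᵥ (Aᵀ *ᵥ w)) = diagonal ![1, -ε, 0] *ᵥ w := by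
    rw [mulVec_mulVec, mulVec_mulVec, h]
  rw [mulVec_transpose, ← dotProduct_mulVec, ← mulVec_transpose, hD] at hv
  have hw : diagonal ![1, -ε, 0] *ᵥ w = 0 := by
    simp [dotProduct, mulVec_diagonal, Fin.sum_univ_three] at hv
    have h1 : w 1 = 0 := by
      by_contra hw1
      exact hε ⟨w 0 / w 1, by field_simp; linear_combination -hv⟩
    have h0 : w 0 = 0 := by simpa [h1] using hv
    ext i
    fin_cases i <;> simp [mulVec_diagonal, h0, h1]
  rw [hw] at hD
  exact (mulVec_injective_iff_isUnit.2 hA) (by simpa using hD)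

theorem exterior_corner {F : Type*} [Field F] (h2 : (2 : F) ≠ 0) (a : F) :
    Exterior !![a, 1, 0; 1, 0, 0; 0, 0, 0] := by
  refine ⟨!![1, (1 - a) / 2, 0; 1, (-1 - a) / 2, 0; 0, 0, 1], ?_, ?_⟩
  · rw [isUnit_iff_isUnit_det, det_fin_three, isUnit_iff_ne_zero]
    simp
    field_simp
    grind
  · ext i j
    fin_cases i <;> fin_cases j <;> simp [Matrix.mul_apply, Fin.sum_univ_three] <;> field_simp <;>
      ring

theorem exterior_cross {F : Type*} [Field F] (h2 : (2 : F) ≠ 0) (b : F) :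
    Exterior !![0, b, 0; b, 0, 1; 0, 1, 0] := by
  refine ⟨!![0, 1, 1 / 2; 0, 1, -1 / 2; 1, 0, -b], ?_, ?_⟩
  · rw [isUnit_iff_isUnit_det, det_fin_three, isUnit_iff_ne_zero]
    simp
    field_simp
    grind
  · ext i j
    fin_cases i <;> fin_cases j <;> simp [Matrix.mul_apply, Fin.sum_univ_three] <;> field_simp <;>
      ring

theorem Exterior.det_eq_zero {F : Type*} [Field F] {M : Matrix (Fin 3) (Fin 3) F}
    (hM : Exterior M) : M.det = 0 := by
  obtain ⟨A, hA, h⟩ := hM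
  have hAdet := ((isUnit_iff_isUnit_det A).1 hA).ne_zero
  have := congrArg det h
  simpa [det_diagonal, Fin.prod_univ_three, hAdet] using this

theorem det_sigma8 {F : Type*} [Field F] (a b c : F) :
    (!![a, b, 0; b, 0, c; 0, c, 0] : Matrix (Fin 3) (Fin 3) F).det = -(a * c ^ 2) := by
  rw [det_fin_three]
  simp
  ring

theorem smul_sigma8 {F : Type*} [Field F] (t a b c : F) :
    t • (!![a, b, 0; b, 0, c; 0, c, 0] : Matrix (Fin 3) (Fin 3) F)
      = !![t * a, t * b, 0; t * b, 0, t * c; 0, t * c, 0] := by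
  ext i j
  fin_cases i <;> fin_cases j <;> simp

theorem sigma8_inj {F : Type*} [Field F] {a b c a' b' c' : F} :
    (!![a, b, 0; b, 0, c; 0, c, 0] : Matrix (Fin 3) (Fin 3) F)
      = !![a', b', 0; b', 0, c'; 0, c', 0] ↔ a = a' ∧ b = b' ∧ c = c' := by
  constructor
  · intro h
    exact ⟨by simpa using congrFun₂ h 0 0, by simpa using congrFun₂ h 0 1,
      by simpa using congrFun₂ h 1 2⟩
  · rintro ⟨rfl, rfl, rfl⟩
    rfl

theorem sigma8_ne_zero {F : Type*} [Field F] {a b c : F} (h : a ≠ 0 ∨ b ≠ 0 ∨ c ≠ 0) :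
    (!![a, b, 0; b, 0, c; 0, c, 0] : Matrix (Fin 3) (Fin 3) F) ≠ 0 := by
  intro h0
  have ha : a = 0 := by simpa using congrFun₂ h0 0 0
  have hb : b = 0 := by simpa using congrFun₂ h0 0 1
  have hc : c = 0 := by simpa using congrFun₂ h0 1 2
  simp [ha, hb, hc] at h

/-- The plane `Σ₈` representative has point-orbit distribution `[1, 2q, 0, q²−q]`. -/
theorem distribution_Sigma8 (F : Type*) [Field F] [Fintype F]
    (hodd : Odd (Fintype.card F)) :
    HasPointOrbitDistribution F
      {M | ∃ a b c : F, M = !![a, b, 0; b, 0, c; 0, c, 0]}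
      1
      (2 * Fintype.card F)
      0
      (Fintype.card F ^ 2 - Fintype.card F) := by
  have h2 : (2 : F) ≠ 0 := Ring.two_ne_zero fun h => by
    have := FiniteField.even_card_of_char_two h
    grind
  have hsmul : ∀ (t : F), ∀ M ∈ {M : Matrix (Fin 3) (Fin 3) F |
      ∃ a b c : F, M = !![a, b, 0; b, 0, c; 0, c, 0]},
      t • M ∈ {M | ∃ a b c : F, M = !![a, b, 0; b, 0, c; 0, c, 0]} := by
    rintro t _ ⟨a, b, c, rfl⟩
    exact ⟨_, _, _, smul_sigma8 t a b c⟩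
  refine ⟨?_, ?_, ?_, ?_⟩
  · rw [ptsWith_eq_card (fun _ : Unit => !![1, 0, 0; 0, 0, 0; 0, 0, 0]) hsmul
      (fun _ => ⟨1, 0, 0, rfl⟩) (fun _ => sigma8_ne_zero (by simp))
      (fun _ => rank_single_corner one_ne_zero) (fun _ _ _ _ => rfl), Nat.card_unique]
    rintro _ ⟨a, b, c, rfl⟩ - hrank
    have hb : b = 0 := by
      by_contra hb
      have := two_le_rank_of_minor_ne_zero !![a, b, 0; b, 0, c; 0, c, 0] ![0, 1] ![0, 1]
        (by rw [det_fin_two]; simp [hb])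
      lia
    have hc : c = 0 := by
      by_contra hc
      have := two_le_rank_of_minor_ne_zero !![a, b, 0; b, 0, c; 0, c, 0] ![1, 2] ![1, 2]
        (by rw [det_fin_two]; simp [hc])
      lia
    refine ⟨(), a, ?_⟩
    rw [smul_sigma8, sigma8_inj]
    simp [hb, hc]
  · rw [ptsWith_eq_card (Sum.elim (fun a : F => !![a, 1, 0; 1, 0, 0; 0, 0, 0])
      (fun b : F => !![0, b, 0; b, 0, 1; 0, 1, 0])) hsmul]
    · rw [Nat.card_sum, Nat.card_eq_fintype_card, two_mul]
    · rintro (a | b)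
      · exact ⟨a, 1, 0, rfl⟩
      · exact ⟨0, b, 1, rfl⟩
    · rintro (a | b) <;> exact sigma8_ne_zero (by simp)
    · rintro (a | b)
      · exact exterior_corner h2 a
      · exact exterior_cross h2 b
    · rintro (a | b) (a' | b') t h <;>
        simp only [Sum.elim_inl, Sum.elim_inr, smul_sigma8, sigma8_inj] at h <;> grind
    · rintro _ ⟨a, b, c, rfl⟩ - hext
      have hdet := hext.det_eq_zero
      rw [det_sigma8] at hdet
      by_cases hc : c = 0
      · subst hc
        have hb : b ≠ 0 := by
          rintro rfl
          obtain ⟨A, -, hA⟩ := hext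
          exact neg_ne_zero.2 one_ne_zero (eq_zero_of_rank_one_congr_diagonal hA)
        refine ⟨Sum.inl (a / b), b, ?_⟩
        rw [Sum.elim_inl, smul_sigma8, sigma8_inj]
        simp [mul_div_cancel₀, hb]
      · have ha : a = 0 := by simpa [hc] using hdet
        refine ⟨Sum.inr (b / c), c, ?_⟩
        rw [Sum.elim_inr, smul_sigma8, sigma8_inj]
        simp [mul_div_cancel₀, hc, ha]
  · rw [ptsWith_eq_card (Empty.elim) hsmul (by simp) (by simp) (by simp) (by simp), Nat.card_of_isEmpty]
    rintro _ ⟨a, b, c, rfl⟩ - hint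
    have h1 := congrFun (hint.mulVec_eq_zero (v := ![0, 1, 0])
      (by simp [dotProduct, mulVec, Fin.sum_univ_three])) 0
    have h2 := congrFun (hint.mulVec_eq_zero (v := ![0, 0, 1])
      (by simp [dotProduct, mulVec, Fin.sum_univ_three])) 1
    have hb : b = 0 := by simpa [mulVec, dotProduct, Fin.sum_univ_three] using h1
    have hc : c = 0 := by simpa [mulVec, dotProduct, Fin.sum_univ_three] using h2
    subst hb hc
    obtain ⟨A, ε, -, hε, hA⟩ := hint
    have := eq_zero_of_rank_one_congr_diagonal hA
    exact absurd (neg_eq_zero.1 this ▸ IsSquare.zero) hε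
  · have hrank (M : Matrix (Fin 3) (Fin 3) F) : M.rank = 3 ↔ M.det ≠ 0 := by
      simpa using M.rank_eq_card_iff_det_ne_zero
    rw [ptsWith_eq_card (fun x : Fˣ × F => !![x.1.1, x.2, 0; x.2, 0, 1; 0, 1, 0]) hsmul]
    · rw [Nat.card_prod, Nat.card_units, Nat.card_eq_fintype_card, Nat.sub_mul, sq, one_mul]
    · exact fun x => ⟨x.1, x.2, 1, rfl⟩
    · exact fun x => sigma8_ne_zero (by simp)
    · intro x
      rw [hrank, det_sigma8]
      simp
    · rintro ⟨u, b⟩ ⟨u', b'⟩ t h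
      simp only [smul_sigma8, sigma8_inj] at h
      obtain ⟨ha, hb, ht⟩ := h
      obtain rfl : t = 1 := by simpa using ht
      simp only [one_mul] at ha hb
      rw [Units.ext ha, hb]
    · rintro _ ⟨a, b, c, rfl⟩ - h
      rw [hrank, det_sigma8] at h
      have ha : a ≠ 0 := by rintro rfl; simp at h
      have hc : c ≠ 0 := by rintro rfl; simp at h
      refine ⟨(Units.mk0 (a / c) (div_ne_zero ha hc), b / c), c, ?_⟩
      rw [smul_sigma8, sigma8_inj]
      simp [mul_div_cancel₀, hc]
end

section
/- Let q be an odd prime power, F = F_q, and let ε ∈ F be a nonsquare. Let W₁₂ = {[[a,b,0],[b,c,b],[0,b,c]] : a,b,c ∈ F} and W₁₃ = {[[a,b,0],[b,c,b],[0,b,εc]] : a,b,c ∈ F} be subspaces of Sym₃(F). Then each of W₁₂ and W₁₃ contains a line of constant rank 3, i.e., a 2-dimensional F-subspace all of whose nonzero matrices have rank 3. -/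
open Matrix

/-- If `δ` and `μ` satisfy `δ = 1` or `μ * (δ - 1) = δ`, some line with slope `μ` misses the cubic
curve `s * (δ * t ^ 2 - 1) = δ * t`. -/
lemma exists_line_missing_nodal_cubic {F : Type*} [Field F] [Finite F] {δ μ : F} (hδ : δ ≠ 0)
    (h : δ = 1 ∨ μ * (δ - 1) = δ) :
    ∃ l : F, ∀ t : F, (l + μ * t) * (δ * t ^ 2 - 1) ≠ δ * t := by
  classical
  let f : F → F := fun t => if δ * t ^ 2 = 1 then 0 else δ * t / (δ * t ^ 2 - 1) - μ * t
  have f_zero : f 0 = 0 := by simp [f]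
  have f_one : f 1 = 0 := by
    by_cases h1 : δ = 1
    · simp [f, h1]
    · have h2 : μ * (δ - 1) = δ := h.resolve_left h1
      have h3 : δ - 1 ≠ 0 := sub_ne_zero.mpr h1
      have h4 : δ / (δ - 1) = μ := (div_eq_iff h3).mpr h2.symm
      simp [f, h1, h4]
  have hf : ¬ Function.Surjective f := fun hs =>
    zero_ne_one (Finite.injective_iff_surjective.mpr hs (f_zero.trans f_one.symm))
  simp only [Function.Surjective, not_forall, not_exists] at hf
  obtain ⟨l, hl⟩ := hf
  refine ⟨l, fun t ht => ?_⟩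
  by_cases h1 : δ * t ^ 2 = 1
  · rw [h1, sub_self, mul_zero, eq_comm, mul_eq_zero, or_iff_right hδ] at ht
    simp [ht] at h1
  · refine hl t ?_
    rw [show f t = _ from if_neg h1, ← ht, mul_div_cancel_right₀ _ (sub_ne_zero.mpr h1),
      add_sub_cancel_right]

/-- The parametrization `(b, c) ↦ (l * b + μ * c, b, c)` of a line in the plane of matrices
`!![a, b, 0; b, c, b; 0, b, δ * c]`. -/
def planeLine {F : Type*} [Field F] (δ l μ : F) : F × F →ₗ[F] Matrix (Fin 3) (Fin 3) F where
  toFun x := !![l * x.1 + μ * x.2, x.1, 0; x.1, x.2, x.1; 0, x.1, δ * x.2]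
  map_add' x y := by
    ext i j
    fin_cases i <;> fin_cases j <;> simp <;> ring
  map_smul' r x := by
    ext i j
    fin_cases i <;> fin_cases j <;> simp <;> ring

lemma planeLine_injective {F : Type*} [Field F] (δ l μ : F) :
    Function.Injective (planeLine δ l μ) := fun _ _ h =>
  Prod.ext (congrFun (congrFun h 0) 1) (congrFun (congrFun h 1) 1)

lemma det_planeLine_ne_zero {F : Type*} [Field F] {δ l μ : F} (hδ : δ ≠ 0) (hμ : μ ≠ 0)
    (hl : ∀ t : F, (l + μ * t) * (δ * t ^ 2 - 1) ≠ δ * t) {x : F × F} (hx : x ≠ 0) :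
    (planeLine δ l μ x).det ≠ 0 := by
  obtain ⟨b, c⟩ := x
  have hdet : (planeLine δ l μ (b, c)).det =
      (l * b + μ * c) * (δ * c ^ 2 - b ^ 2) - δ * b ^ 2 * c := by
    simp [planeLine, det_fin_three]
    ring
  rw [hdet]
  intro h0
  by_cases hb : b = 0
  · have hc : c ≠ 0 := fun hc => hx (by simp [hb, hc])
    refine mul_ne_zero (mul_ne_zero hμ hδ) (pow_ne_zero 3 hc) ?_
    rw [hb] at h0
    linear_combination h0
  · apply hl (c / b)
    field_simp
    linear_combination h0

/-- The plane of matrices `!![a, b, 0; b, c, b; 0, b, δ * c]` contains a line of constant rank 3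
as soon as `δ ≠ 0`. -/
lemma exists_constant_rank_three_line {F : Type*} [Field F] [Finite F] {δ : F} (hδ : δ ≠ 0) :
    ∃ p : Submodule F (Matrix (Fin 3) (Fin 3) F),
      (↑p ⊆ {M : Matrix (Fin 3) (Fin 3) F | ∃ a b c : F, M = !![a, b, 0; b, c, b; 0, b, δ * c]}) ∧
      Module.finrank F ↥p = 2 ∧
      ∀ M ∈ p, M ≠ 0 → M.rank = 3 := by
  obtain ⟨μ, hμ, h⟩ : ∃ μ : F, μ ≠ 0 ∧ (δ = 1 ∨ μ * (δ - 1) = δ) := by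
    by_cases h1 : δ = 1
    · exact ⟨1, one_ne_zero, Or.inl h1⟩
    · have h2 : δ - 1 ≠ 0 := sub_ne_zero.mpr h1
      exact ⟨δ / (δ - 1), div_ne_zero hδ h2, Or.inr (div_mul_cancel₀ δ h2)⟩
  obtain ⟨l, hl⟩ := exists_line_missing_nodal_cubic hδ h
  refine ⟨LinearMap.range (planeLine δ l μ), ?_, ?_, ?_⟩
  · rintro _ ⟨x, rfl⟩
    exact ⟨_, _, _, rfl⟩
  · rw [LinearMap.finrank_range_of_inj (planeLine_injective δ l μ)]
    simp
  · rintro _ ⟨x, rfl⟩ hM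
    have hx : x ≠ 0 := fun hx => hM (by rw [hx, map_zero])
    have hdet := det_planeLine_ne_zero hδ hμ hl hx
    simpa using rank_of_isUnit _ ((isUnit_iff_isUnit_det _).mpr hdet.isUnit)

/-- Each of the plane representatives `Σ₁₂` and `Σ₁₃` contains a line of constant rank 3,
i.e. a 2-dimensional subspace all of whose nonzero matrices have rank 3. -/
theorem Sigma12_Sigma13_contain_constant_rank_three_line (F : Type*) [Field F] [Fintype F]
    (hodd : Odd (Fintype.card F)) (ε : F) (hε : ¬ IsSquare ε) :
    (∃ p : Submodule F (Matrix (Fin 3) (Fin 3) F),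
      (↑p ⊆ {M : Matrix (Fin 3) (Fin 3) F | ∃ a b c : F, M = !![a, b, 0; b, c, b; 0, b, c]}) ∧
      Module.finrank F ↥p = 2 ∧
      ∀ M ∈ p, M ≠ 0 → M.rank = 3) ∧
    (∃ p : Submodule F (Matrix (Fin 3) (Fin 3) F),
      (↑p ⊆ {M : Matrix (Fin 3) (Fin 3) F | ∃ a b c : F, M = !![a, b, 0; b, c, b; 0, b, ε * c]}) ∧
      Module.finrank F ↥p = 2 ∧
      ∀ M ∈ p, M ≠ 0 → M.rank = 3) := by
  have hε0 : ε ≠ 0 := fun h => hε (h ▸ IsSquare.zero)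
  refine ⟨?_, exists_constant_rank_three_line hε0⟩
  simpa only [one_mul] using exists_constant_rank_three_line (one_ne_zero (α := F))
end
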